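/- One has ∫₀^∞ r(x) dx = cos(π/8) − √2/2. -/

import Mathlib

open Real MeasureTheory Set

/-- `η t = (1/4)·log(1+t²) − (1/π)·∫₀^t log|s|/(1+s²) ds`. -/
noncomputable def etaF (t : ℝ) : ℝ :=
  Real.log (1 + t ^ 2) / 4 - (1 / Real.pi) * ∫ s in (0 : ℝ)..t, Real.log |s| / (1 + s ^ 2)

/-- The remainder term `r`. -/
noncomputable def rfun (x : ℝ) : ℝ :=
  (Real.sqrt 2 / (2 * Real.pi)) *
    ∫ t in Ioi (0 : ℝ), (t / (1 + t ^ 2)) * Real.exp (-etaF t) * Real.exp (-t * x)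

open Filter Topology

/-- The horizontal strip `|Im v| < 2π/3`. -/
def wideStrip : Set ℂ := {v | |v.im| < 2 * π / 3}

theorem isOpen_wideStrip : IsOpen wideStrip :=
  isOpen_lt (by fun_prop) continuous_const

theorem convex_wideStrip : Convex ℝ wideStrip := by
  have h : wideStrip = Complex.imCLM ⁻¹' Ioo (-(2 * π / 3)) (2 * π / 3) := by
    ext v; simp [wideStrip, abs_lt]
  rw [h]
  exact (convex_Ioo _ _).linear_preimage Complex.imCLM.toLinearMap

theorem zero_mem_wideStrip : (0 : ℂ) ∈ wideStrip := by
  simp [wideStrip, pi_pos]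

theorem neg_mem_wideStrip {v : ℂ} (hv : v ∈ wideStrip) : -v ∈ wideStrip := by
  simpa [wideStrip] using hv

theorem add_ofReal_mem_wideStrip {v : ℂ} (hv : v ∈ wideStrip) (x : ℝ) : v + x ∈ wideStrip := by
  simpa [wideStrip] using hv

theorem mem_wideStrip_of_abs_im_le {v : ℂ} (hv : |v.im| ≤ π / 2) : v ∈ wideStrip := by
  have := pi_pos
  show |v.im| < 2 * π / 3
  linarith

theorem norm_sinh_sq (v : ℂ) : ‖Complex.sinh v‖ ^ 2 = Real.sinh v.re ^ 2 + Real.sin v.im ^ 2 := by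
  have h : Complex.sinh v = ((Real.sinh v.re * Real.cos v.im : ℝ) : ℂ)
      + ((Real.cosh v.re * Real.sin v.im : ℝ) : ℂ) * Complex.I := by
    conv_lhs => rw [← Complex.re_add_im v]
    rw [Complex.sinh_add, Complex.sinh_mul_I, Complex.cosh_mul_I]
    push_cast
    ring
  rw [h, Complex.sq_norm, Complex.normSq_add_mul_I, mul_pow, mul_pow, Real.cosh_sq, Real.cos_sq']
  ring

theorem sq_le_mul_sin_sq {y : ℝ} (hy : |y| < 2 * π / 3) : y ^ 2 ≤ π ^ 2 * Real.sin y ^ 2 := by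
  have hpi := pi_pos
  have h1 : 2 / π * |y / 2| ≤ |Real.sin (y / 2)| :=
    Real.mul_abs_le_abs_sin (by rw [abs_div, abs_two]; linarith)
  have h2 : 1 / 2 ≤ Real.cos (y / 2) := by
    rw [← Real.cos_abs, ← Real.cos_pi_div_three]
    apply Real.cos_le_cos_of_nonneg_of_le_pi (abs_nonneg _) (by linarith)
    rw [abs_div, abs_two]; linarith
  have h3 : |Real.sin y| = 2 * |Real.sin (y / 2)| * Real.cos (y / 2) := by
    conv_lhs => rw [show y = 2 * (y / 2) by ring, Real.sin_two_mul]
    rw [abs_mul, abs_mul, abs_two, abs_of_nonneg (by linarith : 0 ≤ Real.cos (y / 2))]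
  have h4 : |y| ≤ π * |Real.sin y| := by
    have : |y| ≤ π * |Real.sin (y / 2)| := by
      calc |y| = π * (2 / π * |y / 2|) := by rw [abs_div, abs_two]; field_simp
        _ ≤ _ := by gcongr
    rw [h3]
    nlinarith [mul_nonneg hpi.le (abs_nonneg (Real.sin (y / 2)))]
  calc y ^ 2 = |y| ^ 2 := (sq_abs y).symm
    _ ≤ (π * |Real.sin y|) ^ 2 := by gcongr
    _ = _ := by rw [mul_pow, sq_abs]

theorem norm_le_exp_mul_norm_sinh {v : ℂ} (hv : v ∈ wideStrip) :
    ‖v‖ ≤ 8 * Real.exp (v.re / 2) * ‖Complex.sinh v‖ := by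
  have hpi := pi_pos
  set x := v.re with hx
  set y := v.im with hy
  have hsin : y ^ 2 ≤ π ^ 2 * Real.sin y ^ 2 := sq_le_mul_sin_sq hv
  have hpi2 : π ^ 2 ≤ 15 := by nlinarith [pi_lt_d2]
  have hsinh : Real.sinh x = 2 * Real.sinh (x / 2) * Real.cosh (x / 2) := by
    rw [← Real.sinh_two_mul]; congr 1; ring
  have hsx : (x / 2) ^ 2 ≤ Real.sinh (x / 2) ^ 2 := by
    rw [sq_le_sq, Real.abs_sinh]
    exact Real.self_le_sinh_iff.2 (abs_nonneg _)
  have hc := Real.cosh_sq (x / 2)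
  have hc1 := Real.one_le_cosh (x / 2)
  have hn : ‖v‖ ^ 2 = x ^ 2 + y ^ 2 := by
    rw [Complex.sq_norm, Complex.normSq_apply]; ring
  have hs := norm_sinh_sq v
  have hy1 : Real.sin y ^ 2 ≤ 1 := Real.sin_sq_le_one y
  have hsq : (Real.cosh (x / 2) * ‖v‖) ^ 2 ≤ (4 * ‖Complex.sinh v‖) ^ 2 := by
    rw [mul_pow, mul_pow, hn, hs, ← hx, ← hy, hsinh]
    set s := Real.sinh (x / 2)
    set c := Real.cosh (x / 2)
    have e1 : c ^ 2 * x ^ 2 ≤ 4 * s ^ 2 * c ^ 2 := by nlinarith [sq_nonneg c]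
    have e2 : c ^ 2 * y ^ 2 ≤ 15 * (Real.sin y ^ 2 + s ^ 2) := by
      have : y ^ 2 ≤ 15 * Real.sin y ^ 2 := by nlinarith [sq_nonneg (Real.sin y)]
      rw [hc]
      nlinarith [sq_nonneg s]
    nlinarith [sq_nonneg s, sq_nonneg (s * c), sq_nonneg (Real.sin y),
      mul_nonneg (sq_nonneg s) (sq_nonneg s)]
  have hle : Real.cosh (x / 2) * ‖v‖ ≤ 4 * ‖Complex.sinh v‖ :=
    le_of_sq_le_sq hsq (by positivity)
  have hexp : 1 ≤ 2 * Real.cosh (x / 2) * Real.exp (x / 2) := by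
    rw [Real.cosh_eq]
    have : Real.exp (-(x / 2)) * Real.exp (x / 2) = 1 := by rw [← Real.exp_add]; simp
    nlinarith [Real.exp_pos (x / 2)]
  calc ‖v‖ ≤ (2 * Real.cosh (x / 2) * Real.exp (x / 2)) * ‖v‖ :=
        le_mul_of_one_le_left (norm_nonneg _) hexp
    _ = 2 * Real.exp (x / 2) * (Real.cosh (x / 2) * ‖v‖) := by ring
    _ ≤ 2 * Real.exp (x / 2) * (4 * ‖Complex.sinh v‖) := by gcongr
    _ = _ := by ring

theorem sinh_ne_zero_of_mem_wideStrip {v : ℂ} (hv : v ∈ wideStrip) (h0 : v ≠ 0) :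
    Complex.sinh v ≠ 0 := by
  intro h
  have := norm_le_exp_mul_norm_sinh hv
  rw [h, norm_zero, mul_zero] at this
  exact h0 (norm_le_zero_iff.1 this)

/-- The analytic function `v / sinh v`, with value `1` at `0`. -/
noncomputable def divSinh (v : ℂ) : ℂ := (dslope Complex.sinh 0 v)⁻¹

theorem divSinh_zero : divSinh 0 = 1 := by
  simp [divSinh, Complex.deriv_sinh]

theorem divSinh_of_ne {v : ℂ} (hv : v ≠ 0) : divSinh v = v / Complex.sinh v := by
  simp [divSinh, dslope_of_ne _ hv, slope_def_field]

theorem divSinh_neg (v : ℂ) : divSinh (-v) = divSinh v := by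
  rcases eq_or_ne v 0 with rfl | hv
  · simp
  · rw [divSinh_of_ne hv, divSinh_of_ne (neg_ne_zero.2 hv), Complex.sinh_neg, neg_div_neg_eq]

theorem norm_divSinh_le {v : ℂ} (hv : v ∈ wideStrip) :
    ‖divSinh v‖ ≤ 8 * Real.exp (v.re / 2) := by
  rcases eq_or_ne v 0 with rfl | h0
  · simp [divSinh_zero]
  · rw [divSinh_of_ne h0, norm_div,
      div_le_iff₀ (norm_pos_iff.2 (sinh_ne_zero_of_mem_wideStrip hv h0))]
    exact norm_le_exp_mul_norm_sinh hv

theorem differentiableOn_divSinh : DifferentiableOn ℂ divSinh wideStrip := by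
  have h : DifferentiableOn ℂ (dslope Complex.sinh 0) wideStrip :=
    (Complex.differentiableOn_dslope (isOpen_wideStrip.mem_nhds zero_mem_wideStrip)).2
      Complex.differentiable_sinh.differentiableOn
  refine h.inv fun v hv => ?_
  rcases eq_or_ne v 0 with rfl | h0
  · simp [Complex.deriv_sinh]
  · rw [dslope_of_ne _ h0, slope_def_field]
    simpa using ⟨sinh_ne_zero_of_mem_wideStrip hv h0, h0⟩

theorem continuous_divSinh_add {v : ℂ} (hv : v ∈ wideStrip) :
    Continuous fun x : ℝ => divSinh (v + x) :=
  differentiableOn_divSinh.continuousOn.comp_continuous (by fun_prop)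
    (add_ofReal_mem_wideStrip hv)

theorem integrableOn_exp_half_add (a : ℝ) (c : ℝ) :
    IntegrableOn (fun x : ℝ => Real.exp ((a + x) / 2)) (Iic c) := by
  have h : IntegrableOn (fun x : ℝ => Real.exp (a / 2) * Real.exp (1 / 2 * x)) (Iic c) :=
    (integrableOn_exp_mul_Iic (by norm_num) c).const_mul _
  refine h.congr_fun (fun x _ => ?_) measurableSet_Iic
  simp only [← Real.exp_add]
  congr 1
  ring

theorem integral_exp_half_add (a : ℝ) :
    ∫ x : ℝ in Iic 0, Real.exp ((a + x) / 2) = 2 * Real.exp (a / 2) := by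
  have h : ∀ x : ℝ, Real.exp ((a + x) / 2) = Real.exp (a / 2) * Real.exp (1 / 2 * x) := by
    intro x
    rw [← Real.exp_add]
    congr 1
    ring
  simp_rw [h]
  rw [integral_const_mul, integral_exp_mul_Iic (by norm_num)]
  simp
  ring

theorem integrableOn_divSinh {v : ℂ} (hv : v ∈ wideStrip) (c : ℝ) :
    IntegrableOn (fun x : ℝ => divSinh (v + x)) (Iic c) := by
  refine ((integrableOn_exp_half_add v.re c).const_mul 8).mono'
    (continuous_divSinh_add hv).aestronglyMeasurable (ae_of_all _ fun x => ?_)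
  simpa using norm_divSinh_le (add_ofReal_mem_wideStrip hv x)

/-- The antiderivative of `v / sinh v` on the strip that vanishes at `-∞`. -/
noncomputable def divSinhPrim (v : ℂ) : ℂ := ∫ x : ℝ in Iic 0, divSinh (v + x)

theorem norm_divSinhPrim_le {v : ℂ} (hv : v ∈ wideStrip) :
    ‖divSinhPrim v‖ ≤ 16 * Real.exp (v.re / 2) := by
  calc ‖divSinhPrim v‖ ≤ ∫ x : ℝ in Iic 0, 8 * Real.exp ((v.re + x) / 2) := by
        refine norm_integral_le_of_norm_le ((integrableOn_exp_half_add v.re 0).const_mul 8)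
          (ae_of_all _ fun x => ?_)
        simpa using norm_divSinh_le (add_ofReal_mem_wideStrip hv x)
    _ = _ := by rw [integral_const_mul, integral_exp_half_add]; ring

theorem hasDerivAt_divSinhPrim {v : ℂ} (hv : v ∈ wideStrip) :
    HasDerivAt divSinhPrim (divSinh v) v := by
  obtain ⟨r, hr, hball⟩ := Metric.isOpen_iff.1 isOpen_wideStrip v hv
  have hmem : ∀ u ∈ Metric.ball v (r / 2), ∀ z ∈ Metric.closedBall u (r / 4), ∀ x : ℝ,
      z + x ∈ wideStrip := by
    intro u hu z hz x
    refine add_ofReal_mem_wideStrip (hball ?_) x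
    rw [Metric.mem_ball] at *
    rw [Metric.mem_closedBall] at hz
    linarith [dist_triangle z u v]
  have hd : ∀ u ∈ wideStrip, DifferentiableAt ℂ divSinh u := fun u hu =>
    differentiableOn_divSinh.differentiableAt (isOpen_wideStrip.mem_nhds hu)
  have hbound : ∀ u ∈ Metric.ball v (r / 2), ∀ x : ℝ,
      ‖deriv divSinh (u + x)‖ ≤ 8 * Real.exp ((v.re + r + x) / 2) / (r / 4) := by
    intro u hu x
    have hcl : ∀ z ∈ Metric.closedBall (u + (x : ℂ)) (r / 4), z ∈ wideStrip ∧
        z.re ≤ v.re + r + x := by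
      intro z hz
      have hz' : z - x ∈ Metric.closedBall u (r / 4) := by
        rw [Metric.mem_closedBall, dist_eq_norm] at *
        rwa [show z - x - u = z - (u + x) by ring]
      refine ⟨by simpa using hmem u hu _ hz' x, ?_⟩
      have h1 : ‖z - x - v‖ ≤ r := by
        rw [Metric.mem_ball] at hu
        rw [Metric.mem_closedBall] at hz'
        rw [← dist_eq_norm]
        linarith [dist_triangle (z - x) u v]
      have h2 := (Complex.re_le_norm (z - x - v)).trans h1
      simp at h2
      linarith
    refine Complex.norm_deriv_le_of_forall_mem_sphere_norm_le (by positivity) ?_ fun z hz => ?_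
    · refine DifferentiableOn.diffContOnCl fun z hz => ?_
      rw [closure_ball _ (by positivity)] at hz
      exact (hd z (hcl z hz).1).differentiableWithinAt
    · have hz' := hcl z (Metric.sphere_subset_closedBall hz)
      refine (norm_divSinh_le hz'.1).trans ?_
      gcongr
      exact hz'.2
  have hderivx : ∀ x : ℝ, HasDerivAt (fun x : ℝ => divSinh (v + x)) (deriv divSinh (v + x)) x := by
    intro x
    have h := (hd (v + x) (add_ofReal_mem_wideStrip hv x)).hasDerivAt
    have h2 : HasDerivAt (fun x : ℝ => v + (x : ℂ)) 1 x := by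
      simpa using (Complex.ofRealCLM.hasDerivAt (x := x)).const_add v
    simpa [Function.comp_def] using h.scomp x h2
  have hcont : Continuous fun x : ℝ => deriv divSinh (v + x) :=
    ((differentiableOn_divSinh.deriv isOpen_wideStrip).continuousOn).comp_continuous
      (by fun_prop) (add_ofReal_mem_wideStrip hv)
  obtain ⟨hint, hder⟩ := hasDerivAt_integral_of_dominated_loc_of_deriv_le
    (μ := volume.restrict (Iic (0 : ℝ))) (F := fun u x => divSinh (u + (x : ℂ)))
    (F' := fun u x => deriv divSinh (u + (x : ℂ))) (x₀ := v)
    (bound := fun x => 8 * Real.exp ((v.re + r + x) / 2) / (r / 4))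
    (Metric.ball_mem_nhds v (by positivity : 0 < r / 2))
    (by
      filter_upwards [isOpen_wideStrip.mem_nhds hv] with u hu
      exact (continuous_divSinh_add hu).aestronglyMeasurable)
    (integrableOn_divSinh hv 0) hcont.aestronglyMeasurable
    (ae_of_all _ fun x u hu => hbound u hu x)
    (((integrableOn_exp_half_add (v.re + r) 0).const_mul 8).div_const _)
    (ae_of_all _ fun x u hu => by
      have h := (hd (u + x) (hmem u hu u (Metric.mem_closedBall_self (by positivity)) x)).hasDerivAt
      simpa using h.comp_add_const u (x : ℂ))
  have hlim : Tendsto (fun x : ℝ => divSinh (v + x)) atBot (𝓝 0) := by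
    refine squeeze_zero_norm (a := fun x : ℝ => 8 * Real.exp ((v.re + x) / 2)) (fun x => ?_) ?_
    · simpa using norm_divSinh_le (add_ofReal_mem_wideStrip hv x)
    · have : Tendsto (fun x : ℝ => (v.re + x) / 2) atBot atBot :=
        (tendsto_atBot_add_const_left _ _ tendsto_id).atBot_div_const (by norm_num)
      simpa using (Real.tendsto_exp_atBot.comp this).const_mul 8
  have hval := integral_Iic_of_hasDerivAt_of_tendsto (a := (0 : ℝ))
    (hderivx 0).continuousAt.continuousWithinAt (fun x _ => hderivx x) hint hlim
  rw [hval] at hder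
  simpa using! hder

theorem integral_Iic_comp_add {E : Type*} [NormedAddCommGroup E] [NormedSpace ℝ E] (f : ℝ → E)
    (c : ℝ) : ∫ x in Iic 0, f (c + x) = ∫ x in Iic c, f x := by
  have h := (measurePreserving_add_left volume c).setIntegral_preimage_emb
    (measurableEmbedding_addLeft c) f (Iic c)
  rw [← h]
  congr 2
  ext x
  simp

theorem divSinhPrim_ofReal_add (w : ℂ) (x : ℝ) :
    divSinhPrim (x + w) = ∫ s : ℝ in Iic x, divSinh (w + s) := by
  rw [← integral_Iic_comp_add (fun s : ℝ => divSinh (w + s)) x, divSinhPrim]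
  congr 1
  ext s
  push_cast
  ring_nf

theorem divSinh_upper (x : ℝ) :
    divSinh (((π / 2 : ℝ) : ℂ) * Complex.I + x)
      = ((π / 2 / Real.cosh x : ℝ) : ℂ) + ((-(x / Real.cosh x) : ℝ) : ℂ) * Complex.I := by
  have hc : (Complex.cosh x) ≠ 0 := by
    rw [← Complex.ofReal_cosh]; exact_mod_cast (Real.cosh_pos x).ne'
  have h0 : ((π / 2 : ℝ) : ℂ) * Complex.I + x ≠ 0 := by
    intro h
    have := congrArg Complex.im h
    simp [pi_ne_zero] at this
  have hs : Complex.sinh (((π / 2 : ℝ) : ℂ) * Complex.I + x) = Complex.I * Complex.cosh x := by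
    rw [Complex.sinh_add, Complex.sinh_mul_I, Complex.cosh_mul_I, ← Complex.ofReal_sin,
      ← Complex.ofReal_cos, Real.sin_pi_div_two, Real.cos_pi_div_two]
    simp
  rw [divSinh_of_ne h0, hs]
  push_cast
  field_simp
  linear_combination (2 * (x : ℂ)) * Complex.I_sq

theorem divSinh_lower (x : ℝ) :
    divSinh (-(((π / 2 : ℝ) : ℂ) * Complex.I) + x)
      = ((π / 2 / Real.cosh x : ℝ) : ℂ) + ((x / Real.cosh x : ℝ) : ℂ) * Complex.I := by
  have h := divSinh_upper (-x)
  rw [← divSinh_neg] at h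
  rw [Real.cosh_neg, neg_div, neg_neg] at h
  rw [← h]
  congr 1
  push_cast
  ring

theorem upper_mem_wideStrip : ((π / 2 : ℝ) : ℂ) * Complex.I ∈ wideStrip := by
  apply mem_wideStrip_of_abs_im_le
  simp [abs_of_pos (half_pos pi_pos)]

theorem integrableOn_inv_cosh (c : ℝ) :
    IntegrableOn (fun x => π / 2 / Real.cosh x) (Iic c) := by
  have h := (integrableOn_divSinh upper_mem_wideStrip c).re
  refine Integrable.congr h (ae_of_all _ fun x => ?_)
  simp only [divSinh_upper]
  simp [-Complex.ofReal_div]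

theorem integrableOn_id_div_cosh (c : ℝ) :
    IntegrableOn (fun x => x / Real.cosh x) (Iic c) := by
  have h := (integrableOn_divSinh (neg_mem_wideStrip upper_mem_wideStrip) c).im
  refine Integrable.congr h (ae_of_all _ fun x => ?_)
  simp only [divSinh_lower]
  simp [-Complex.ofReal_div]

theorem integral_inv_cosh (c : ℝ) :
    ∫ x in Iic c, π / 2 / Real.cosh x = π * Real.arctan (Real.exp c) := by
  have hd : ∀ x : ℝ, HasDerivAt (fun x => π * Real.arctan (Real.exp x)) (π / 2 / Real.cosh x) x := by
    intro x
    have h := ((Real.hasDerivAt_exp x).arctan).const_mul π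
    refine h.congr_deriv ?_
    rw [Real.cosh_eq, Real.exp_neg]
    have := Real.exp_pos x
    field_simp
    ring
  have hlim : Tendsto (fun x => π * Real.arctan (Real.exp x)) atBot (𝓝 (π * Real.arctan 0)) :=
    ((Real.continuous_arctan.tendsto 0).comp Real.tendsto_exp_atBot).const_mul π
  rw [integral_Iic_of_hasDerivAt_of_tendsto (hd c).continuousAt.continuousWithinAt
    (fun x _ => hd x) (integrableOn_inv_cosh c) hlim]
  simp

theorem integral_re_add_im_mul_I {s : Set ℝ} {f g : ℝ → ℝ} (hf : IntegrableOn f s)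
    (hg : IntegrableOn g s) :
    ∫ x in s, ((f x : ℂ) + (g x : ℂ) * Complex.I)
      = ((∫ x in s, f x : ℝ) : ℂ) + ((∫ x in s, g x : ℝ) : ℂ) * Complex.I := by
  rw [integral_add hf.ofReal (hg.ofReal.mul_const _), integral_mul_const, integral_complex_ofReal,
    integral_complex_ofReal]

theorem divSinhPrim_upper (x : ℝ) :
    divSinhPrim (x + ((π / 2 : ℝ) : ℂ) * Complex.I)
      = ((π * Real.arctan (Real.exp x) : ℝ) : ℂ)
        + ((-∫ s in Iic x, s / Real.cosh s : ℝ) : ℂ) * Complex.I := by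
  rw [divSinhPrim_ofReal_add]
  simp_rw [divSinh_upper]
  rw [integral_re_add_im_mul_I (g := fun s => -(s / Real.cosh s)) (integrableOn_inv_cosh x)
    (integrableOn_id_div_cosh x).neg, integral_inv_cosh, integral_neg]

theorem divSinhPrim_lower (x : ℝ) :
    divSinhPrim (x + -(((π / 2 : ℝ) : ℂ) * Complex.I))
      = ((π * Real.arctan (Real.exp x) : ℝ) : ℂ)
        + ((∫ s in Iic x, s / Real.cosh s : ℝ) : ℂ) * Complex.I := by
  rw [divSinhPrim_ofReal_add]
  simp_rw [divSinh_lower]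
  rw [integral_re_add_im_mul_I (integrableOn_inv_cosh x) (integrableOn_id_div_cosh x),
    integral_inv_cosh]

theorem divSinhPrim_add_neg {v : ℂ} (hv : v ∈ wideStrip) :
    divSinhPrim v + divSinhPrim (-v) = ((π ^ 2 / 2 : ℝ) : ℂ) := by
  have hd : ∀ u ∈ wideStrip, HasDerivAt (fun u => divSinhPrim u + divSinhPrim (-u)) 0 u := by
    intro u hu
    have h2 : HasDerivAt (fun u => divSinhPrim (-u)) (divSinh (-u) * -1) u :=
      (hasDerivAt_divSinhPrim (neg_mem_wideStrip hu)).comp u (hasDerivAt_neg u)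
    have h := (hasDerivAt_divSinhPrim hu).add h2
    rw [divSinh_neg, mul_neg_one, add_neg_cancel] at h
    exact h
  have hc := isOpen_wideStrip.is_const_of_deriv_eq_zero convex_wideStrip.isPreconnected
    (fun u hu => (hd u hu).differentiableAt.differentiableWithinAt)
    (fun u hu => (hd u hu).deriv) hv upper_mem_wideStrip
  have h1 := divSinhPrim_upper 0
  have h2 := divSinhPrim_lower 0
  rw [Complex.ofReal_zero, zero_add] at h1 h2
  rw [hc, h1, h2, Real.exp_zero, Real.arctan_one]
  push_cast
  ring

theorem divSinhPrim_zero : divSinhPrim 0 = ((π ^ 2 / 4 : ℝ) : ℂ) := by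
  have h := divSinhPrim_add_neg zero_mem_wideStrip
  rw [neg_zero] at h
  push_cast at h ⊢
  linear_combination h / 2

theorem norm_divSinhPrim_le_const {v : ℂ} (hv : v ∈ wideStrip) : ‖divSinhPrim v‖ ≤ 24 := by
  have key : ∀ u ∈ wideStrip, u.re ≤ 0 → ‖divSinhPrim u‖ ≤ 16 := by
    intro u hu h
    refine (norm_divSinhPrim_le hu).trans ?_
    have : Real.exp (u.re / 2) ≤ 1 := Real.exp_le_one_iff.2 (by linarith)
    linarith
  rcases le_total v.re 0 with h | h
  · linarith [key v hv h]
  · have h1 := key (-v) (neg_mem_wideStrip hv) (by simpa using h)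
    have h2 : divSinhPrim v = ((π ^ 2 / 2 : ℝ) : ℂ) - divSinhPrim (-v) := by
      rw [← divSinhPrim_add_neg hv]; ring
    have h3 : ‖((π ^ 2 / 2 : ℝ) : ℂ)‖ ≤ 8 := by
      rw [Complex.norm_real, Real.norm_of_nonneg (by positivity)]
      nlinarith [pi_lt_four, pi_pos]
    rw [h2]
    exact (norm_sub_le _ _).trans (by linarith)

/-- The analytic function `√(1 + eᵛ) · exp (i M(v) / (2π))`, where `M` is the antiderivative of
`v / sinh v`. -/
noncomputable def whFactor (v : ℂ) : ℂ :=
  Complex.exp (Complex.log (1 + Complex.exp v) / 2 + Complex.I / (2 * π) * divSinhPrim v)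

theorem one_add_exp_mem_slitPlane {v : ℂ} (hv : v ∈ wideStrip) :
    1 + Complex.exp v ∈ Complex.slitPlane := by
  rw [Complex.mem_slitPlane_iff]
  have hpi := pi_pos
  have hv' : |v.im| < 2 * π / 3 := hv
  rw [abs_lt] at hv'
  by_cases h : v.im = 0
  · left
    simp [Complex.exp_re, h]
    positivity
  · right
    simp only [Complex.add_im, Complex.one_im, zero_add, Complex.exp_im]
    refine mul_ne_zero (Real.exp_pos _).ne' fun hs => h ?_
    exact (Real.sin_eq_zero_iff_of_lt_of_lt (by linarith) (by linarith)).1 hs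

theorem differentiableOn_whFactor : DifferentiableOn ℂ whFactor wideStrip := by
  intro v hv
  have h1 : DifferentiableAt ℂ (fun v => 1 + Complex.exp v) v := by fun_prop
  have h2 := h1.clog (one_add_exp_mem_slitPlane hv)
  have h3 := (hasDerivAt_divSinhPrim hv).differentiableAt
  exact ((h2.div_const 2).add (h3.const_mul _)).cexp.differentiableWithinAt

theorem whFactor_zero :
    whFactor 0 = ((√2 : ℝ) : ℂ) * Complex.exp (((π / 8 : ℝ) : ℂ) * Complex.I) := by
  have h2 : ((√2 : ℝ) : ℂ) = Complex.exp (Complex.log 2 / 2) := by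
    rw [Real.sqrt_eq_rpow, Real.rpow_def_of_pos (by norm_num)]
    push_cast
    rw [Complex.ofReal_log (by norm_num)]
    push_cast
    ring_nf
  have hpi : (π : ℂ) ≠ 0 := by exact_mod_cast pi_ne_zero
  rw [whFactor, divSinhPrim_zero, h2, ← Complex.exp_add, Complex.exp_zero]
  norm_num
  congr 2
  field_simp
  norm_num

theorem whFactor_zero_re : (whFactor 0).re = √2 * Real.cos (π / 8) := by
  rw [whFactor_zero, Complex.re_ofReal_mul, Complex.exp_ofReal_mul_I_re]

theorem norm_whFactor_le {v : ℂ} (hv : |v.im| ≤ π / 2) :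
    ‖whFactor v‖ ≤ (1 + Real.exp v.re) * Real.exp 24 := by
  have hvs := mem_wideStrip_of_abs_im_le hv
  have hpi := pi_gt_three
  set z := 1 + Complex.exp v with hz
  have hz1 : 1 ≤ ‖z‖ := by
    have hre : 1 ≤ z.re := by
      have : 0 ≤ Real.cos v.im := Real.cos_nonneg_of_mem_Icc (abs_le.1 hv)
      simp only [hz, Complex.add_re, Complex.one_re, Complex.exp_re]
      have := mul_nonneg (Real.exp_pos v.re).le this
      linarith
    exact hre.trans (Complex.re_le_norm z)
  have hz2 : ‖z‖ ≤ 1 + Real.exp v.re := by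
    refine (norm_add_le _ _).trans ?_
    rw [Complex.norm_exp]; simp
  have hlog : 0 ≤ Real.log ‖z‖ := Real.log_nonneg hz1
  have h1 : (Complex.log z / 2).re ≤ Real.log ‖z‖ := by
    have : (Complex.log z / 2).re = Real.log ‖z‖ / 2 := by
      rw [show (2 : ℂ) = ((2 : ℝ) : ℂ) by norm_num, Complex.div_ofReal_re, Complex.log_re]
    linarith
  have h2 : (Complex.I / (2 * π) * divSinhPrim v).re ≤ 24 := by
    refine (Complex.re_le_norm _).trans ?_
    rw [norm_mul, norm_div, Complex.norm_I, norm_mul, Complex.norm_real,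
      Real.norm_of_nonneg pi_pos.le, Complex.norm_ofNat]
    have h3 : 1 / (2 * π) ≤ 1 := by
      rw [div_le_one (by positivity)]; linarith
    calc _ ≤ 1 * (24 : ℝ) := mul_le_mul h3 (norm_divSinhPrim_le_const hvs) (norm_nonneg _) zero_le_one
      _ = 24 := one_mul _
  rw [whFactor, Complex.norm_exp, Complex.add_re]
  calc _ ≤ Real.exp (Real.log ‖z‖ + 24) := by gcongr
    _ = ‖z‖ * Real.exp 24 := by rw [Real.exp_add, Real.exp_log (by linarith)]
    _ ≤ _ := by gcongr

theorem log_one_add_mul_I (t : ℝ) :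
    Complex.log (1 + (t : ℂ) * Complex.I)
      = ((Real.log (1 + t ^ 2) / 2 : ℝ) : ℂ) + ((Real.arctan t : ℝ) : ℂ) * Complex.I := by
  have hn : ‖1 + (t : ℂ) * Complex.I‖ = √(1 + t ^ 2) := by
    rw [← Complex.ofReal_one, Complex.norm_add_mul_I, one_pow]
  apply Complex.ext
  · rw [Complex.log_re, hn, Real.log_sqrt (by positivity)]
    simp [-Complex.ofReal_div, -Complex.ofReal_arctan]
  · rw [Complex.log_im, Complex.arg_of_re_nonneg (by simp), hn, Real.arctan_eq_arcsin]
    simp [-Complex.ofReal_div]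

theorem exp_ofReal_add_upper (x : ℝ) :
    Complex.exp (x + ((π / 2 : ℝ) : ℂ) * Complex.I) = ((Real.exp x : ℝ) : ℂ) * Complex.I := by
  rw [Complex.exp_add, Complex.ofReal_div, Complex.ofReal_ofNat, Complex.exp_pi_div_two_mul_I,
    Complex.ofReal_exp]

theorem exp_ofReal_add_lower (x : ℝ) :
    Complex.exp (x + -(((π / 2 : ℝ) : ℂ) * Complex.I))
      = ((-Real.exp x : ℝ) : ℂ) * Complex.I := by
  rw [Complex.exp_add, Complex.exp_neg, Complex.ofReal_div, Complex.ofReal_ofNat,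
    Complex.exp_pi_div_two_mul_I, Complex.inv_I, Complex.ofReal_neg, Complex.ofReal_exp]
  ring

theorem exp_image_Iic (x : ℝ) : Real.exp '' Iic x = Ioc 0 (Real.exp x) := by
  ext t
  constructor
  · rintro ⟨s, hs, rfl⟩
    exact ⟨Real.exp_pos s, Real.exp_le_exp.2 hs⟩
  · rintro ⟨h0, ht⟩
    exact ⟨Real.log t, (Real.log_le_iff_le_exp h0).2 ht, Real.exp_log h0⟩

theorem etaF_exp (x : ℝ) :
    etaF (Real.exp x) = Real.log (1 + Real.exp x ^ 2) / 4
      - 1 / (2 * π) * ∫ s in Iic x, s / Real.cosh s := by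
  have h : ∫ s in (0 : ℝ)..Real.exp x, Real.log |s| / (1 + s ^ 2)
      = (1 / 2) * ∫ s in Iic x, s / Real.cosh s := by
    rw [intervalIntegral.integral_of_le (Real.exp_pos x).le, ← exp_image_Iic,
      integral_image_eq_integral_abs_deriv_smul measurableSet_Iic
        (fun s _ => (Real.hasDerivAt_exp s).hasDerivWithinAt) Real.exp_injective.injOn,
      ← integral_const_mul]
    congr 1
    ext s
    have hs := Real.exp_pos s
    rw [Real.abs_exp, Real.log_exp, Real.cosh_eq, Real.exp_neg, smul_eq_mul]
    field_simp
    ring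
  rw [etaF, h]
  field_simp

theorem whFactor_lower (x : ℝ) :
    whFactor (x + -(((π / 2 : ℝ) : ℂ) * Complex.I)) = ((Real.exp (etaF (Real.exp x)) : ℝ) : ℂ) := by
  have hpi : (π : ℂ) ≠ 0 := by exact_mod_cast pi_ne_zero
  rw [whFactor, exp_ofReal_add_lower, log_one_add_mul_I, divSinhPrim_lower, neg_sq,
    Real.arctan_neg, etaF_exp, Complex.ofReal_exp]
  congr 1
  push_cast [-Complex.ofReal_arctan]
  field_simp
  linear_combination (8 * ((∫ s in Iic x, s / Real.cosh s : ℝ) : ℂ)) * Complex.I_sq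

theorem whFactor_upper (x : ℝ) :
    whFactor (x + ((π / 2 : ℝ) : ℂ) * Complex.I)
      = ((Real.exp (-etaF (Real.exp x)) : ℝ) : ℂ) * (1 + ((Real.exp x : ℝ) : ℂ) * Complex.I) := by
  have hpi : (π : ℂ) ≠ 0 := by exact_mod_cast pi_ne_zero
  have hne : 1 + ((Real.exp x : ℝ) : ℂ) * Complex.I ≠ 0 := by
    intro h
    have := congrArg Complex.re h
    simp [-Complex.ofReal_exp] at this
  rw [← Complex.exp_log hne, whFactor, exp_ofReal_add_upper, log_one_add_mul_I, divSinhPrim_upper,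
    etaF_exp, Complex.ofReal_exp, ← Complex.exp_add]
  congr 1
  push_cast [-Complex.ofReal_arctan, -Complex.ofReal_exp]
  field_simp
  linear_combination (-8 * ((∫ s in Iic x, s / Real.cosh s : ℝ) : ℂ)) * Complex.I_sq

/-- The analytic extension of `(whFactor v - whFactor 0) / (1 - e²ᵛ)` across `0`. -/
noncomputable def whQuot (v : ℂ) : ℂ :=
  -(1 / 2) * dslope whFactor 0 v * divSinh v * Complex.exp (-v)

theorem differentiableOn_whQuot : DifferentiableOn ℂ whQuot wideStrip := by
  have h : DifferentiableOn ℂ (dslope whFactor 0) wideStrip :=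
    (Complex.differentiableOn_dslope (isOpen_wideStrip.mem_nhds zero_mem_wideStrip)).2
      differentiableOn_whFactor
  exact ((h.const_mul _).mul differentiableOn_divSinh).mul (by fun_prop)

theorem whQuot_of_ne {v : ℂ} (hv : v ∈ wideStrip) (h0 : v ≠ 0) :
    whQuot v = (whFactor v - whFactor 0) / (1 - Complex.exp v ^ 2) := by
  have hs := sinh_ne_zero_of_mem_wideStrip hv h0
  have he := Complex.exp_ne_zero v
  have h1 : 1 - Complex.exp v ^ 2 = -(2 * Complex.exp v * Complex.sinh v) := by
    rw [Complex.sinh, Complex.exp_neg]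
    field_simp
    ring
  rw [whQuot, dslope_of_ne _ h0, slope_def_field, divSinh_of_ne h0, sub_zero, Complex.exp_neg, h1]
  field_simp

theorem one_add_exp_sq_pos (x : ℝ) : 0 < 1 + Real.exp x ^ 2 := by positivity

theorem whQuot_lower_sub_upper_im (x : ℝ) :
    (whQuot (x + -(((π / 2 : ℝ) : ℂ) * Complex.I))).im
        - (whQuot (x + ((π / 2 : ℝ) : ℂ) * Complex.I)).im
      = -(Real.exp x * (Real.exp (-etaF (Real.exp x)) / (1 + Real.exp x ^ 2))) := by
  have hup : (x : ℂ) + ((π / 2 : ℝ) : ℂ) * Complex.I ∈ wideStrip := by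
    rw [add_comm]; exact add_ofReal_mem_wideStrip upper_mem_wideStrip x
  have hlo : (x : ℂ) + -(((π / 2 : ℝ) : ℂ) * Complex.I) ∈ wideStrip := by
    rw [add_comm]; exact add_ofReal_mem_wideStrip (neg_mem_wideStrip upper_mem_wideStrip) x
  have hup0 : (x : ℂ) + ((π / 2 : ℝ) : ℂ) * Complex.I ≠ 0 := by
    intro h
    have := congrArg Complex.im h
    simp [pi_ne_zero] at this
  have hlo0 : (x : ℂ) + -(((π / 2 : ℝ) : ℂ) * Complex.I) ≠ 0 := by
    intro h
    have := congrArg Complex.im h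
    simp [pi_ne_zero] at this
  have hden : ∀ a : ℂ, a ^ 2 = ((Real.exp x : ℝ) : ℂ) ^ 2 →
      1 - (a * Complex.I) ^ 2 = ((1 + Real.exp x ^ 2 : ℝ) : ℂ) := by
    intro a ha
    rw [mul_pow, Complex.I_sq, ha]
    push_cast
    ring
  rw [whQuot_of_ne hup hup0, whQuot_of_ne hlo hlo0, exp_ofReal_add_upper, exp_ofReal_add_lower,
    hden _ rfl, hden _ (by push_cast; ring), Complex.div_ofReal_im, Complex.div_ofReal_im,
    whFactor_lower, whFactor_upper, Complex.sub_im, Complex.sub_im, Complex.ofReal_im,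
    Complex.im_ofReal_mul]
  have := (one_add_exp_sq_pos x).ne'
  simp only [Complex.add_im, Complex.one_im, Complex.im_ofReal_mul, Complex.I_im]
  field_simp
  ring

theorem intervalIntegrable_log_abs_div (a b : ℝ) :
    IntervalIntegrable (fun s : ℝ => Real.log |s| / (1 + s ^ 2)) volume a b := by
  simp_rw [Real.log_abs, div_eq_mul_inv]
  refine intervalIntegral.intervalIntegrable_log'.mul_continuousOn (Continuous.continuousOn ?_)
  exact Continuous.inv₀ (by fun_prop) fun s => by positivity

theorem continuous_etaF : Continuous etaF := by
  have h := intervalIntegral.continuous_primitive intervalIntegrable_log_abs_div 0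
  have h2 : Continuous fun t : ℝ => Real.log (1 + t ^ 2) :=
    Continuous.log (by fun_prop) fun t => by positivity
  exact (h2.div_const 4).sub (continuous_const.mul h)

theorem etaF_nonneg {t : ℝ} (ht : 0 ≤ t) : 0 ≤ etaF t := by
  have hpi := pi_gt_three
  have hint : ∫ s in (0 : ℝ)..t, s / (1 + s ^ 2) = Real.log (1 + t ^ 2) / 2 := by
    have hd : ∀ s : ℝ, HasDerivAt (fun s => Real.log (1 + s ^ 2) / 2) (s / (1 + s ^ 2)) s := by
      intro s
      have h1 : HasDerivAt (fun s : ℝ => 1 + s ^ 2) (2 * s) s := by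
        simpa using (hasDerivAt_pow 2 s).const_add 1
      refine ((h1.log (by positivity)).div_const 2).congr_deriv ?_
      field_simp
    rw [intervalIntegral.integral_eq_sub_of_hasDerivAt (fun s _ => hd s)]
    · simp
    · refine Continuous.intervalIntegrable ?_ _ _
      exact continuous_id.div (by fun_prop) fun s => by positivity
  have hle : ∫ s in (0 : ℝ)..t, Real.log |s| / (1 + s ^ 2) ≤ Real.log (1 + t ^ 2) / 2 := by
    rw [← hint]
    refine intervalIntegral.integral_mono_on ht (intervalIntegrable_log_abs_div 0 t) ?_ ?_
    · refine Continuous.intervalIntegrable ?_ _ _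
      exact continuous_id.div (by fun_prop) fun s => by positivity
    · intro s hs
      have : Real.log |s| ≤ s := by
        rw [abs_of_nonneg hs.1]
        exact Real.log_le_self hs.1
      gcongr
  have hlog : 0 ≤ Real.log (1 + t ^ 2) := Real.log_nonneg (by nlinarith)
  have h1 : 1 / π * ∫ s in (0 : ℝ)..t, Real.log |s| / (1 + s ^ 2)
      ≤ 1 / π * (Real.log (1 + t ^ 2) / 2) := by gcongr
  have h2 : 1 / π * (Real.log (1 + t ^ 2) / 2) ≤ 1 / 2 * (Real.log (1 + t ^ 2) / 2) := by
    gcongr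
    linarith
  rw [etaF]
  linarith

theorem abs_im_le_of_mem_uIoc {x y : ℝ} (hy : y ∈ uIoc (-(π / 2)) (π / 2)) :
    |((x : ℂ) + (y : ℂ) * Complex.I).im| ≤ π / 2 := by
  rw [uIoc_of_le (by linarith [pi_pos])] at hy
  simpa [abs_le] using ⟨hy.1.le, hy.2⟩

theorem tendsto_integral_whQuot_right :
    Tendsto (fun R : ℝ => ∫ y in -(π / 2)..π / 2, whQuot ((R : ℂ) + (y : ℂ) * Complex.I))
      atTop (𝓝 0) := by
  set A := 2 * Real.exp 24 + ‖whFactor 0‖ with hA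
  have hA0 : 0 ≤ A := by positivity
  have hbound : ∀ R : ℝ, 1 ≤ R → ∀ y ∈ uIoc (-(π / 2)) (π / 2),
      ‖whQuot ((R : ℂ) + (y : ℂ) * Complex.I)‖ ≤ 2 * A * Real.exp (-R) := by
    intro R hR y hy
    have him := abs_im_le_of_mem_uIoc (x := R) hy
    set v := (R : ℂ) + (y : ℂ) * Complex.I with hv
    have hre : v.re = R := by simp [hv]
    have h0 : v ≠ 0 := by
      intro h
      rw [h, Complex.zero_re] at hre
      linarith
    have hE : 2 ≤ Real.exp R := by linarith [Real.add_one_le_exp R]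
    have hP : ‖whFactor v - whFactor 0‖ ≤ A * Real.exp R := by
      have h1 := norm_whFactor_le him
      rw [hre] at h1
      have h2 : ‖whFactor 0‖ ≤ ‖whFactor 0‖ * Real.exp R :=
        le_mul_of_one_le_right (norm_nonneg _) (by linarith)
      have h3 : (1 + Real.exp R) * Real.exp 24 ≤ 2 * Real.exp R * Real.exp 24 := by
        gcongr; linarith
      rw [hA]
      linarith [norm_sub_le (whFactor v) (whFactor 0)]
    have hD : Real.exp R ^ 2 / 2 ≤ ‖1 - Complex.exp v ^ 2‖ := by
      have h1 := norm_sub_norm_le (Complex.exp v ^ 2) 1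
      rw [norm_pow, Complex.norm_exp, hre, norm_one, norm_sub_rev] at h1
      nlinarith
    rw [whQuot_of_ne (mem_wideStrip_of_abs_im_le him) h0, norm_div]
    calc _ ≤ A * Real.exp R / (Real.exp R ^ 2 / 2) := by gcongr
      _ = _ := by
        have := Real.exp_pos R
        rw [Real.exp_neg]
        field_simp
  refine squeeze_zero_norm' (a := fun R => 2 * A * Real.exp (-R) * |π / 2 - -(π / 2)|) ?_ ?_
  · filter_upwards [eventually_ge_atTop 1] with R hR
    exact intervalIntegral.norm_integral_le_of_norm_le_const (hbound R hR)
  · have h := ((Real.tendsto_exp_neg_atTop_nhds_zero.const_mul (2 * A)).mul_const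
      |π / 2 - -(π / 2)|)
    simpa using h

theorem tendsto_exp_neg_add_mul_I (y : ℝ) :
    Tendsto (fun R : ℝ => Complex.exp (((-R : ℝ) : ℂ) + (y : ℂ) * Complex.I)) atTop (𝓝 0) := by
  refine squeeze_zero_norm (a := fun R : ℝ => Real.exp (-R)) (fun R => ?_)
    Real.tendsto_exp_neg_atTop_nhds_zero
  rw [Complex.norm_exp]
  simp

theorem tendsto_whFactor_left (y : ℝ) (hy : y ∈ uIoc (-(π / 2)) (π / 2)) :
    Tendsto (fun R : ℝ => whFactor (((-R : ℝ) : ℂ) + (y : ℂ) * Complex.I)) atTop (𝓝 1) := by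
  have hexp := tendsto_exp_neg_add_mul_I y
  have hprim : Tendsto (fun R : ℝ => divSinhPrim (((-R : ℝ) : ℂ) + (y : ℂ) * Complex.I))
      atTop (𝓝 0) := by
    refine squeeze_zero_norm (a := fun R : ℝ => 16 * Real.exp (-R / 2)) (fun R => ?_) ?_
    · simpa using norm_divSinhPrim_le
        (mem_wideStrip_of_abs_im_le (abs_im_le_of_mem_uIoc (x := -R) hy))
    · have h : Tendsto (fun R : ℝ => -R / 2) atTop atBot :=
        tendsto_neg_atTop_atBot.atBot_div_const (by norm_num)
      simpa using (Real.tendsto_exp_atBot.comp h).const_mul 16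
  have hlog : Tendsto (fun R : ℝ => Complex.log
      (1 + Complex.exp (((-R : ℝ) : ℂ) + (y : ℂ) * Complex.I))) atTop (𝓝 0) := by
    have h := (hexp.const_add 1).clog (by simp)
    simpa using h
  have h := (Complex.continuous_exp.tendsto _).comp
    ((hlog.div_const 2).add (hprim.const_mul (Complex.I / (2 * π))))
  simpa [Function.comp_def, whFactor] using h

theorem continuousOn_whQuot_vertical (x : ℝ) :
    ContinuousOn (fun y : ℝ => whQuot ((x : ℂ) + (y : ℂ) * Complex.I)) (uIoc (-(π / 2)) (π / 2)) :=
  differentiableOn_whQuot.continuousOn.comp (by fun_prop) fun _ hy =>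
    mem_wideStrip_of_abs_im_le (abs_im_le_of_mem_uIoc hy)

theorem tendsto_integral_whQuot_left :
    Tendsto (fun R : ℝ => ∫ y in -(π / 2)..π / 2, whQuot (((-R : ℝ) : ℂ) + (y : ℂ) * Complex.I))
      atTop (𝓝 ((π : ℂ) * (1 - whFactor 0))) := by
  set A := 2 * Real.exp 24 + ‖whFactor 0‖ with hA
  have hne : ∀ R : ℝ, 1 ≤ R → ∀ y : ℝ, ((-R : ℝ) : ℂ) + (y : ℂ) * Complex.I ≠ 0 := by
    intro R hR y h
    have := congrArg Complex.re h
    simp at this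
    linarith
  have hval : ∫ _ in -(π / 2)..π / 2, (1 - whFactor 0) = (π : ℂ) * (1 - whFactor 0) := by
    rw [intervalIntegral.integral_const]
    simp
  rw [← hval]
  refine intervalIntegral.tendsto_integral_filter_of_dominated_convergence (fun _ => 2 * A)
    ?_ ?_ intervalIntegrable_const ?_
  · exact Eventually.of_forall fun R =>
      (continuousOn_whQuot_vertical _).aestronglyMeasurable measurableSet_uIoc
  · filter_upwards [eventually_ge_atTop 1] with R hR
    refine ae_of_all _ fun y hy => ?_
    have him := abs_im_le_of_mem_uIoc (x := -R) hy
    have h0 := hne R hR y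
    set v := ((-R : ℝ) : ℂ) + (y : ℂ) * Complex.I with hv
    have hre : v.re = -R := by simp [hv]
    have hE : Real.exp (-R) ≤ 1 / 2 := by
      rw [Real.exp_neg, inv_le_comm₀ (Real.exp_pos R) (by norm_num)]
      linarith [Real.add_one_le_exp R]
    have hP : ‖whFactor v - whFactor 0‖ ≤ A := by
      have h1 := norm_whFactor_le him
      rw [hre] at h1
      have h3 : (1 + Real.exp (-R)) * Real.exp 24 ≤ 2 * Real.exp 24 := by
        gcongr; linarith
      rw [hA]
      linarith [norm_sub_le (whFactor v) (whFactor 0)]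
    have hD : 1 / 2 ≤ ‖1 - Complex.exp v ^ 2‖ := by
      have h1 := norm_sub_norm_le 1 (Complex.exp v ^ 2)
      rw [norm_pow, Complex.norm_exp, hre, norm_one] at h1
      nlinarith [Real.exp_pos (-R)]
    rw [whQuot_of_ne (mem_wideStrip_of_abs_im_le him) h0, norm_div]
    calc _ ≤ A / (1 / 2) := by gcongr
      _ = _ := by ring
  · refine ae_of_all _ fun y hy => ?_
    have hexp := tendsto_exp_neg_add_mul_I y
    have h := ((tendsto_whFactor_left y hy).sub_const (whFactor 0)).div
      ((hexp.pow 2).const_sub 1) (by simp)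
    have h2 : Tendsto (fun R : ℝ => whQuot (((-R : ℝ) : ℂ) + (y : ℂ) * Complex.I)) atTop
        (𝓝 ((1 - whFactor 0) / (1 - 0 ^ 2))) := by
      refine h.congr' ?_
      filter_upwards [eventually_ge_atTop 1] with R hR
      exact (whQuot_of_ne (mem_wideStrip_of_abs_im_le (abs_im_le_of_mem_uIoc (x := -R) hy))
        (hne R hR y)).symm
    simpa using h2

theorem continuous_whQuot_add {w : ℂ} (hw : w ∈ wideStrip) :
    Continuous fun x : ℝ => whQuot (x + w) := by
  refine differentiableOn_whQuot.continuousOn.comp_continuous (by fun_prop) fun x => ?_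
  rw [add_comm]
  exact add_ofReal_mem_wideStrip hw x

theorem intervalIntegral_im {f : ℝ → ℂ} (hf : Continuous f) (a b : ℝ) :
    (∫ x in a..b, f x).im = ∫ x in a..b, (f x).im :=
  (Complex.imCLM.intervalIntegral_comp_comm (hf.intervalIntegrable a b)).symm

theorem integral_exp_mul_exp_neg_etaF (R : ℝ) :
    ∫ x in -R..R, Real.exp x * (Real.exp (-etaF (Real.exp x)) / (1 + Real.exp x ^ 2))
      = (∫ y in -(π / 2)..π / 2, whQuot ((R : ℂ) + (y : ℂ) * Complex.I)).re
        - (∫ y in -(π / 2)..π / 2, whQuot (((-R : ℝ) : ℂ) + (y : ℂ) * Complex.I)).re := by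
  have hpi := pi_pos
  have hcauchy := Complex.integral_boundary_rect_eq_zero_of_differentiableOn whQuot
    ⟨-R, -(π / 2)⟩ ⟨R, π / 2⟩ (differentiableOn_whQuot.mono (by
      intro v hv
      have h := hv.2
      rw [mem_preimage, uIcc_of_le (by simp only; linarith)] at h
      exact mem_wideStrip_of_abs_im_le (abs_le.2 h)))
  simp only [smul_eq_mul] at hcauchy
  have him := congrArg Complex.im hcauchy
  have hneg : ((-(π / 2) : ℝ) : ℂ) * Complex.I = -(((π / 2 : ℝ) : ℂ) * Complex.I) := by
    push_cast; ring
  rw [hneg] at him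
  have hlo := continuous_whQuot_add (neg_mem_wideStrip upper_mem_wideStrip)
  have hup := continuous_whQuot_add upper_mem_wideStrip
  have hloi : Continuous fun x : ℝ => (whQuot (x + -(((π / 2 : ℝ) : ℂ) * Complex.I))).im :=
    Complex.continuous_im.comp hlo
  have hupi : Continuous fun x : ℝ => (whQuot (x + ((π / 2 : ℝ) : ℂ) * Complex.I)).im :=
    Complex.continuous_im.comp hup
  rw [Complex.sub_im, Complex.add_im, Complex.sub_im, intervalIntegral_im hlo,
    intervalIntegral_im hup, Complex.I_mul_im, Complex.I_mul_im, Complex.zero_im,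
    ← intervalIntegral.integral_sub
      (hloi.intervalIntegrable _ _) (hupi.intervalIntegrable _ _)] at him
  simp_rw [whQuot_lower_sub_upper_im] at him
  rw [intervalIntegral.integral_neg] at him
  linarith

theorem integrableOn_exp_neg_etaF :
    IntegrableOn (fun t => Real.exp (-etaF t) / (1 + t ^ 2)) (Ioi 0) := by
  refine (integrable_inv_one_add_sq.integrableOn (s := Ioi 0)).mono' ?_ ?_
  · refine Continuous.aestronglyMeasurable ?_
    exact (continuous_etaF.neg.rexp).div (by fun_prop) fun t => by positivity
  · refine (ae_restrict_iff' measurableSet_Ioi).2 (ae_of_all _ fun t ht => ?_)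
    rw [Real.norm_of_nonneg (by positivity), ← one_div]
    have h : Real.exp (-etaF t) ≤ 1 :=
      Real.exp_le_one_iff.2 (neg_nonpos.2 (etaF_nonneg (le_of_lt ht)))
    gcongr

theorem integral_exp_neg_etaF :
    ∫ t in Ioi (0 : ℝ), Real.exp (-etaF t) / (1 + t ^ 2) = π * (√2 * Real.cos (π / 8) - 1) := by
  have hd : ∀ x ∈ (univ : Set ℝ), HasDerivWithinAt Real.exp (Real.exp x) univ x := fun x _ =>
    (Real.hasDerivAt_exp x).hasDerivWithinAt
  have hint := integrableOn_exp_neg_etaF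
  rw [← Real.range_exp, ← image_univ] at hint ⊢
  rw [integrableOn_image_iff_integrableOn_abs_deriv_smul MeasurableSet.univ hd
    Real.exp_injective.injOn, integrableOn_univ] at hint
  rw [integral_image_eq_integral_abs_deriv_smul MeasurableSet.univ hd Real.exp_injective.injOn,
    setIntegral_univ]
  have hlim := intervalIntegral_tendsto_integral hint tendsto_neg_atTop_atBot tendsto_id
  simp only [Real.abs_exp, smul_eq_mul, id, integral_exp_mul_exp_neg_etaF] at hlim ⊢
  have hlim2 := ((Complex.continuous_re.tendsto _).comp tendsto_integral_whQuot_right).sub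
    ((Complex.continuous_re.tendsto _).comp tendsto_integral_whQuot_left)
  rw [tendsto_nhds_unique hlim hlim2, Complex.re_ofReal_mul, Complex.sub_re, whFactor_zero_re,
    Complex.zero_re, Complex.one_re]
  ring

theorem integral_rfun :
    (∫ x in Ioi (0 : ℝ), rfun x) = Real.cos (Real.pi / 8) - Real.sqrt 2 / 2 := by
  have hexp : ∀ t : ℝ, 0 < t → ∫ x in Ioi (0 : ℝ), Real.exp (-t * x) = 1 / t := by
    intro t ht
    rw [integral_exp_mul_Ioi (neg_neg_of_pos ht)]
    simp
  have hinner : ∀ t ∈ Ioi (0 : ℝ),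
      ∫ x in Ioi (0 : ℝ), (t / (1 + t ^ 2)) * Real.exp (-etaF t) * Real.exp (-t * x)
        = Real.exp (-etaF t) / (1 + t ^ 2) := by
    intro t ht
    have ht' : t ≠ 0 := ne_of_gt ht
    rw [integral_const_mul, hexp t ht]
    field_simp
  have hcont : Continuous fun p : ℝ × ℝ =>
      (p.2 / (1 + p.2 ^ 2)) * Real.exp (-etaF p.2) * Real.exp (-p.2 * p.1) := by
    have h1 : Continuous fun p : ℝ × ℝ => p.2 / (1 + p.2 ^ 2) :=
      continuous_snd.div (by fun_prop) fun p => by positivity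
    exact (h1.mul (continuous_etaF.comp continuous_snd).neg.rexp).mul (by fun_prop)
  have hprod : Integrable (Function.uncurry fun x t : ℝ =>
      (t / (1 + t ^ 2)) * Real.exp (-etaF t) * Real.exp (-t * x))
      ((volume.restrict (Ioi 0)).prod (volume.restrict (Ioi 0))) := by
    refine (integrable_prod_iff' hcont.aestronglyMeasurable).2 ⟨?_, ?_⟩
    · refine (ae_restrict_iff' measurableSet_Ioi).2 (ae_of_all _ fun t ht => ?_)
      exact (integrableOn_exp_mul_Ioi (neg_neg_of_pos ht) 0).const_mul
        (t / (1 + t ^ 2) * Real.exp (-etaF t))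
    · refine integrableOn_exp_neg_etaF.congr_fun (fun t ht => ?_) measurableSet_Ioi
      have ht0 : 0 < t := ht
      refine (hinner t ht).symm.trans ?_
      congr 1
      ext x
      exact (Real.norm_of_nonneg (by positivity)).symm
  simp only [rfun]
  rw [integral_const_mul, integral_integral_swap hprod,
    setIntegral_congr_fun measurableSet_Ioi hinner, integral_exp_neg_etaF]
  have hs : √2 * √2 = 2 := Real.mul_self_sqrt (by norm_num)
  have hpi := pi_ne_zero
  field_simp
  linear_combination Real.cos (π / 8) * hs
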